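/- Under Assumptions 1 and 3, let Γ be a constrained potential game with potential φ and let {P^ε} be the PHPIP chain with κ ∈ (0,1/2], with unique stationary distribution μ(ε) for each ε ∈ (0,1/2]. Then every stochastically stable state belongs to diag(argmax_{a∈A} φ(a)): if lim_{ε→0+} μ_z(ε) > 0, then z = (a*, a*) for some a* ∈ argmax_{a∈A} φ(a). -/

import Mathlib

open Filter Topology Set

attribute [local instance] Classical.propDecidable

section PHPIP

variable {ι : Type*} [Fintype ι] [DecidableEq ι] {A : ι → Type*} [∀ i, Fintype (A i)]

/-- Assumption 1 on the constraint maps. -/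
def Assumption1 (C : ∀ i, A i → Finset (A i)) : Prop :=
  (∀ (i : ι) (a b : A i), b ∈ C i a ↔ a ∈ C i b) ∧
  (∀ (i : ι) (a b : A i), ∃ (nf : ℕ) (f : ℕ → A i), f 0 = a ∧ f nf = b ∧
      ∀ k < nf, f (k + 1) ∈ C i (f k)) ∧
  (∀ (i : ι) (a : A i), 3 ≤ (C i a).card)

/-- Assumption 3: unilateral constrained deviations change the utility by less than 1/2. -/
def Assumption3 (U : ι → (∀ i, A i) → ℝ) (C : ∀ i, A i → Finset (A i)) : Prop :=
  ∀ (i : ι) (a : ∀ j, A j) (b : A i), b ∈ C i (a i) →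
    U i (Function.update a i b) - U i a < 1 / 2

/-- Γ is a constrained potential game with potential function φ. -/
def IsPotentialGame (U : ι → (∀ i, A i) → ℝ) (C : ∀ i, A i → Finset (A i))
    (φ : (∀ i, A i) → ℝ) : Prop :=
  ∀ (i : ι) (a : ∀ j, A j) (b : A i), b ∈ C i (a i) →
    U i (Function.update a i b) - U i a = φ (Function.update a i b) - φ a

/-- Probability that, from state `(a0, a1)`, player `i` selects the action `x`
under the PHPIP selection rule with exploration rate `ε` and parameter `κ`. -/
noncomputable def selProb (κ : ℝ) (U : ι → (∀ i, A i) → ℝ)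
    (C : ∀ i, A i → Finset (A i)) (ε : ℝ) (a0 a1 : ∀ i, A i) (i : ι) (x : A i) : ℝ :=
  if U i a0 ≤ U i a1 then
    (if x = a1 i then 1 - ε else 0) +
      (if x ∈ (C i (a1 i)).erase (a1 i) then
        ε / ((C i (a1 i)).erase (a1 i)).card else 0)
  else
    (if x = a1 i then (1 - ε) * (κ * ε ^ (U i a0 - U i a1)) else 0) +
      (if x = a0 i then (1 - ε) * (1 - κ * ε ^ (U i a0 - U i a1)) else 0) +
      (if x ∈ ((C i (a1 i)).erase (a1 i)).erase (a0 i) then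
        ε / (((C i (a1 i)).erase (a1 i)).erase (a0 i)).card else 0)

/-- One-step transition probability of the Markov chain `{P^ε}` induced by PHPIP
on pairs of joint actions. -/
noncomputable def phTrans (κ : ℝ) (U : ι → (∀ i, A i) → ℝ)
    (C : ∀ i, A i → Finset (A i)) (ε : ℝ)
    (z1 z2 : (∀ i, A i) × (∀ i, A i)) : ℝ :=
  if z2.1 = z1.2 then ∏ i, selProb κ U C ε z1.1 z1.2 i (z2.2 i) else 0

/-- The state space B. -/
def memB (C : ∀ i, A i → Finset (A i)) (z : (∀ i, A i) × (∀ i, A i)) : Prop :=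
  ∀ i, z.2 i ∈ C i (z.1 i)

/-- k-step transition probabilities of the homogeneous chain `{P^ε}`. -/
noncomputable def phTransPow (κ : ℝ) (U : ι → (∀ i, A i) → ℝ)
    (C : ∀ i, A i → Finset (A i)) (ε : ℝ) :
    ℕ → (∀ i, A i) × (∀ i, A i) → (∀ i, A i) × (∀ i, A i) → ℝ
  | 0, z, z' => if z = z' then 1 else 0
  | k + 1, z, z' => ∑ w : (∀ i, A i) × (∀ i, A i),
      phTrans κ U C ε z w * phTransPow κ U C ε k w z'

/-- Probability of a path (sequence of states) of the chain `{P^ε}`. -/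
noncomputable def pathProb (κ : ℝ) (U : ι → (∀ i, A i) → ℝ)
    (C : ∀ i, A i → Finset (A i)) (ε : ℝ) :
    List ((∀ i, A i) × (∀ i, A i)) → ℝ
  | [] => 1
  | [_] => 1
  | z :: z' :: rest => phTrans κ U C ε z z' * pathProb κ U C ε (z' :: rest)

/-- A transition is feasible if it has positive probability for some ε ∈ (0,1/2]. -/
def Feasible (κ : ℝ) (U : ι → (∀ i, A i) → ℝ) (C : ∀ i, A i → Finset (A i))
    (z z' : (∀ i, A i) × (∀ i, A i)) : Prop :=
  ∃ ε : ℝ, 0 < ε ∧ ε ≤ 1 / 2 ∧ 0 < phTrans κ U C ε z z'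

/-- `l` is a (feasible) path of the chain from `z1` to `z2`. -/
def IsPath (κ : ℝ) (U : ι → (∀ i, A i) → ℝ) (C : ∀ i, A i → Finset (A i))
    (z1 z2 : (∀ i, A i) × (∀ i, A i)) (l : List ((∀ i, A i) × (∀ i, A i))) : Prop :=
  l.head? = some z1 ∧ l.getLast? = some z2 ∧ l.Chain' (Feasible κ U C)

/-- `r` is the resistance of the path `l`:  `lim_{ε→0+} P^ε(l)/ε^r ∈ (0,∞)`. -/
def IsPathRes (κ : ℝ) (U : ι → (∀ i, A i) → ℝ) (C : ∀ i, A i → Finset (A i))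
    (l : List ((∀ i, A i) × (∀ i, A i))) (r : ℝ) : Prop :=
  ∃ L : ℝ, 0 < L ∧
    Tendsto (fun ε : ℝ => pathProb κ U C ε l / ε ^ r) (𝓝[>] (0 : ℝ)) (𝓝 L)

/-- `(a, b)` (as diagonal states `((a,a),(b,b))`) is a pair in `E_s`:
exactly one player deviates and the deviation is feasible. -/
def EsPair (C : ∀ i, A i → Finset (A i)) (a b : ∀ i, A i) : Prop :=
  (∃! i, a i ≠ b i) ∧ ∀ i, a i ≠ b i → b i ∈ C i (a i)

/-- The path (list of states) of the M-straight-route through the given diagonal nodes. -/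
def msrPath : List (∀ i, A i) → List ((∀ i, A i) × (∀ i, A i))
  | [] => []
  | [a] => [(a, a)]
  | a :: b :: rest => (a, a) :: (a, b) :: msrPath (b :: rest)

/-- Weight of the edge of the graph `G_R` from `z` to `z'`: the minimal resistance
among all paths of `{P^ε}` from `z` to `z'`. -/
noncomputable def edgeWeight (κ : ℝ) (U : ι → (∀ i, A i) → ℝ)
    (C : ∀ i, A i → Finset (A i)) (z z' : (∀ i, A i) × (∀ i, A i)) : ℝ :=
  sInf {r : ℝ | ∃ l, IsPath κ U C z z' l ∧ IsPathRes κ U C l r}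

/-- `y` is reachable from `x` in at most `d` constraint-feasible steps. -/
def ReachIn (C : ∀ i, A i → Finset (A i)) (i : ι) : ℕ → A i → A i → Prop
  | 0, x, y => x = y
  | d + 1, x, y => ReachIn C i d x y ∨ ∃ w, ReachIn C i d x w ∧ y ∈ C i w

/-- Inhomogeneous products: `transProd κ U C εs k0 m` is the transition matrix
`P(k0, k0 + m) = ∏_{k'=k0}^{k0+m-1} P_{k'}` of the PIPIP chain with exploration
rates `εs`. -/
noncomputable def transProd (κ : ℝ) (U : ι → (∀ i, A i) → ℝ)
    (C : ∀ i, A i → Finset (A i)) (εs : ℕ → ℝ) (k0 : ℕ) :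
    ℕ → (∀ i, A i) × (∀ i, A i) → (∀ i, A i) × (∀ i, A i) → ℝ
  | 0, z, z' => if z = z' then 1 else 0
  | m + 1, z, z' => ∑ w : (∀ i, A i) × (∀ i, A i),
      transProd κ U C εs k0 m z w * phTrans κ U C (εs (k0 + m)) w z'

/-- The PIPIP exploration rate `ε(k) = k^{-1/(n(D+1))}`. -/
noncomputable def pipipRate (n D : ℕ) (k : ℕ) : ℝ :=
  (k : ℝ) ^ (-(1 : ℝ) / ((n : ℝ) * ((D : ℝ) + 1)))

/-- Accessibility along the unperturbed chain `{P^0}`. -/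
def Accessible0 (κ : ℝ) (U : ι → (∀ i, A i) → ℝ) (C : ∀ i, A i → Finset (A i))
    (z z' : (∀ i, A i) × (∀ i, A i)) : Prop :=
  ∃ k : ℕ, 0 < phTransPow κ U C 0 k z z'

/-- A recurrent communication class of the unperturbed chain `{P^0}`. -/
def IsRecClass (κ : ℝ) (U : ι → (∀ i, A i) → ℝ) (C : ∀ i, A i → Finset (A i))
    (H : Set ((∀ i, A i) × (∀ i, A i))) : Prop :=
  H.Nonempty ∧ (∀ z ∈ H, ∀ z' ∈ H, Accessible0 κ U C z z') ∧
    (∀ z ∈ H, ∀ z', Accessible0 κ U C z z' → z' ∈ H)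

end PHPIP

section FiniteChain

variable {Z : Type*} [Fintype Z]

/-- The minimal solution of the Dirichlet problem: the probability that the chain first meets
`D` in `S`. It lies below every nonnegative supersolution. -/
theorem exists_hitting_function (P : Z → Z → ℝ) (hP : ∀ z w, 0 ≤ P z w)
    (hP1 : ∀ z, ∑ w, P z w = 1) (D S : Set Z) :
    ∃ f : Z → ℝ, (∀ z, 0 ≤ f z) ∧ (∀ z, f z ≤ 1) ∧ (∀ z ∈ S, f z = 1) ∧
      (∀ z ∈ D, z ∉ S → f z = 0) ∧ (∀ z ∉ S, z ∉ D → f z = ∑ w, P z w * f w) ∧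
      ∀ g : Z → ℝ, (∀ z, 0 ≤ g z) → (∀ z ∈ S, 1 ≤ g z) →
        (∀ z ∉ S, z ∉ D → ∑ w, P z w * g w ≤ g z) → ∀ z, f z ≤ g z := by
  let F : (Z → ℝ) → Z → ℝ := fun f z =>
    if z ∈ S then 1 else if z ∈ D then 0 else ∑ w, P z w * f w
  have hF : Monotone F := by
    intro f g hfg z
    simp only [F]
    split_ifs
    · exact le_rfl
    · exact le_rfl
    · exact Finset.sum_le_sum fun w _ => mul_le_mul_of_nonneg_left (hfg w) (hP z w)
  have hF0 : (0 : Z → ℝ) ≤ F 0 := by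
    intro z
    simp only [F]
    split_ifs <;> simp
  have hmono : Monotone fun n => F^[n] 0 := hF.monotone_iterate_of_le_map hF0
  have hsuper : ∀ g : Z → ℝ, (∀ z, 0 ≤ g z) → (∀ z ∈ S, 1 ≤ g z) →
      (∀ z ∉ S, z ∉ D → ∑ w, P z w * g w ≤ g z) → ∀ n, F^[n] 0 ≤ g := by
    intro g h0 h1 h2 n
    induction n with
    | zero => exact h0
    | succ n ih =>
      rw [Function.iterate_succ_apply']
      refine (hF ih).trans fun z => ?_
      simp only [F]
      split_ifs with hS hD
      · exact h1 z hS
      · exact h0 z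
      · exact h2 z hS hD
  have hle1 : ∀ n, F^[n] 0 ≤ fun _ => (1 : ℝ) :=
    hsuper _ (fun _ => zero_le_one) (fun _ _ => le_rfl) (fun z _ _ => by simp [hP1])
  let f : Z → ℝ := fun z => ⨆ n, F^[n] 0 z
  have hbdd : ∀ z, BddAbove (range fun n => F^[n] 0 z) := fun z =>
    ⟨1, by rintro _ ⟨n, rfl⟩; exact hle1 n z⟩
  have htend : Tendsto (fun n => F^[n] 0) atTop (𝓝 f) :=
    tendsto_pi_nhds.2 fun z => tendsto_atTop_ciSup (fun m n h => hmono h z) (hbdd z)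
  have hcont : Continuous F := by
    refine continuous_pi fun z => ?_
    simp only [F]
    split_ifs <;> fun_prop
  have hfix : F f = f := isFixedPt_of_tendsto_iterate htend hcont.continuousAt
  have hfg : ∀ g : Z → ℝ, (∀ n, F^[n] 0 ≤ g) → ∀ z, f z ≤ g z := fun g hg z =>
    ciSup_le fun n => hg n z
  refine ⟨f, fun z => le_ciSup (hbdd z) 0, hfg _ hle1, fun z hz => ?_, fun z hz hz' => ?_,
    fun z hz hz' => ?_, fun g h0 h1 h2 => hfg g (hsuper g h0 h1 h2)⟩
  · rw [← hfix]; simp [F, hz]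
  · rw [← hfix]; simp [F, hz, hz']
  · conv_lhs => rw [← hfix]
    simp [F, hz, hz']

theorem sum_stationary_mul (P : Z → Z → ℝ) (μ f : Z → ℝ)
    (hμ : ∀ w, ∑ z, μ z * P z w = μ w) :
    ∑ z, μ z * (f z - ∑ w, P z w * f w) = 0 := by
  simp only [mul_sub, Finset.sum_sub_distrib, Finset.mul_sum]
  rw [Finset.sum_comm, sub_eq_zero]
  refine Finset.sum_congr rfl fun w _ => ?_
  rw [← hμ w, Finset.sum_mul]
  exact Finset.sum_congr rfl fun z _ => by ring

/-- If every proper nonempty set has an element dominated, up to the factor `K`, by an element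
of its complement, then all values are comparable. -/
theorem le_pow_mul_of_cut {X : Type*} [Fintype X] (M : X → ℝ) (hM : ∀ x, 0 ≤ M x) (K : ℝ)
    (hK : 1 ≤ K)
    (h : ∀ S : Set X, S.Nonempty → S ≠ univ → ∃ a ∈ S, ∃ b ∉ S, M a ≤ K * M b) (x y : X) :
    M x ≤ K ^ Fintype.card X * M y := by
  let S : ℕ → Finset X := fun j => Finset.univ.filter fun w => M x ≤ K ^ j * M w
  have hmem : ∀ j w, w ∈ S j ↔ M x ≤ K ^ j * M w := fun j w => by simp [S]
  have hmono : ∀ j, S j ⊆ S (j + 1) := fun j w hw => by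
    rw [hmem] at hw ⊢
    exact hw.trans (mul_le_mul_of_nonneg_right (pow_le_pow_right₀ hK j.le_succ) (hM w))
  have hx : ∀ j, x ∈ S j := fun j => by
    rw [hmem]
    exact le_mul_of_one_le_left (hM x) (one_le_pow₀ hK)
  have hcard : ∀ j, S j = Finset.univ ∨ j < (S j).card := by
    intro j
    induction j with
    | zero => exact Or.inr (Finset.card_pos.2 ⟨x, hx 0⟩)
    | succ j ih =>
      rcases ih with ih | ih
      · left
        exact Finset.eq_univ_of_forall fun w => hmono j (ih ▸ Finset.mem_univ w)
      by_cases hu : S j = Finset.univ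
      · left
        exact Finset.eq_univ_of_forall fun w => hmono j (hu ▸ Finset.mem_univ w)
      right
      obtain ⟨a, ha, b, hb, hab⟩ := h (S j) ⟨x, hx j⟩ (by simpa using hu)
      have ha' := (hmem j a).1 ha
      have hb' : b ∈ S (j + 1) := by
        rw [hmem, pow_succ, mul_assoc]
        exact ha'.trans (mul_le_mul_of_nonneg_left hab (by positivity))
      have : (S j).card < (S (j + 1)).card :=
        Finset.card_lt_card ⟨hmono j, fun hs => hb (hs hb')⟩
      omega
  rcases hcard (Fintype.card X) with hu | hc
  · exact (hmem _ y).1 (hu ▸ Finset.mem_univ y)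
  · exact absurd hc (not_lt.2 (Finset.card_le_univ _))

end FiniteChain

section Selection

variable {ι : Type*} {A : ι → Type*} (κ : ℝ) (U : ι → (∀ i, A i) → ℝ)
  (C : ∀ i, A i → Finset (A i)) (ε : ℝ)

/-- The action chosen without exploration and in the limit `ε → 0`. -/
noncomputable def greedy (a0 a1 : ∀ i, A i) : ∀ i, A i :=
  fun i => if U i a0 ≤ U i a1 then a1 i else a0 i

/-- The resistance of the selection of `x` by player `i`. -/
noncomputable def moveCost (a0 a1 : ∀ i, A i) (i : ι) (x : A i) : ℝ :=
  if U i a0 ≤ U i a1 then (if x = a1 i then 0 else 1)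
  else if x = a0 i then 0 else if x = a1 i then U i a0 - U i a1 else 1

theorem moveCost_nonneg (a0 a1 : ∀ i, A i) (i : ι) (x : A i) : 0 ≤ moveCost U a0 a1 i x := by
  unfold moveCost
  split_ifs <;> linarith

theorem greedy_diag (a : ∀ i, A i) : greedy U a a = a := by
  funext i
  simp [greedy]

theorem moveCost_of_explore {a0 a1 : ∀ i, A i} {i : ι} {x : A i} (h0 : x ≠ a0 i)
    (h1 : x ≠ a1 i) : moveCost U a0 a1 i x = 1 := by
  unfold moveCost
  split_ifs <;> simp_all

/-- A selection that is not greedy has a cost, even after a discount of `1 / 2` when it is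
a fresh action. -/
theorem moveCost_ge_of_ne_greedy {δ : ℝ} (hδ : δ ≤ 1 / 2)
    (hδU : ∀ i a b, U i b < U i a → δ ≤ U i a - U i b)
    {a0 a1 : ∀ i, A i} {i : ι} {x : A i} (hx : x ≠ greedy U a0 a1 i) :
    (if x ≠ a0 i ∧ x ≠ a1 i then 1 / 2 else 0) + δ ≤ moveCost U a0 a1 i x := by
  unfold moveCost
  unfold greedy at hx
  by_cases h : U i a0 ≤ U i a1
  · simp only [h, if_true] at hx ⊢
    rw [if_neg hx]
    split_ifs <;> linarith
  · simp only [h, if_false] at hx ⊢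
    rw [if_neg hx]
    have := hδU i a0 a1 (not_le.1 h)
    by_cases h1 : x = a1 i
    · simp [h1]; linarith
    · simp [h1, hx]; linarith

theorem moveCost_ge_half (a0 a1 : ∀ i, A i) (i : ι) (x : A i) :
    (if x ≠ a0 i ∧ x ≠ a1 i then (1 : ℝ) / 2 else 0) ≤ moveCost U a0 a1 i x := by
  split_ifs with h
  · rw [moveCost_of_explore U h.1 h.2]; norm_num
  · exact moveCost_nonneg U _ _ _ _

theorem card_erase_pos (hC : ∀ i a, 3 ≤ (C i a).card) (i : ι) (x : A i) :
    0 < ((C i x).erase x).card := by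
  have := hC i x
  have := Finset.pred_card_le_card_erase (s := C i x) (a := x)
  omega

theorem card_erase_erase_pos (hC : ∀ i a, 3 ≤ (C i a).card) (i : ι) (x y : A i) :
    0 < (((C i x).erase x).erase y).card := by
  have := hC i x
  have := Finset.pred_card_le_card_erase (s := C i x) (a := x)
  have := Finset.pred_card_le_card_erase (s := (C i x).erase x) (a := y)
  omega

variable {κ ε}

theorem stay_weight_mem (hκ0 : 0 < κ) (hκ : κ ≤ 1 / 2) (hε0 : 0 < ε) (hε : ε ≤ 1 / 2) {d : ℝ}
    (hd : 0 ≤ d) : 0 ≤ κ * ε ^ d ∧ κ * ε ^ d ≤ ε ^ d ∧ κ * ε ^ d ≤ 1 := by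
  have h0 : 0 ≤ ε ^ d := Real.rpow_nonneg hε0.le d
  have h1 : ε ^ d ≤ 1 := Real.rpow_le_one hε0.le (by linarith) hd
  exact ⟨by positivity, by nlinarith, by nlinarith⟩

theorem selProb_nonneg (hκ0 : 0 < κ) (hκ : κ ≤ 1 / 2) (hε0 : 0 < ε) (hε : ε ≤ 1 / 2)
    (a0 a1 : ∀ i, A i) (i : ι) (x : A i) : 0 ≤ selProb κ U C ε a0 a1 i x := by
  unfold selProb
  by_cases h : U i a0 ≤ U i a1
  · rw [if_pos h]
    refine add_nonneg ?_ ?_ <;> split_ifs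
    · linarith
    · exact le_rfl
    · positivity
    · exact le_rfl
  · rw [if_neg h]
    obtain ⟨h1, -, h3⟩ := stay_weight_mem hκ0 hκ hε0 hε (d := U i a0 - U i a1) (by linarith)
    refine add_nonneg (add_nonneg ?_ ?_) ?_ <;> split_ifs
    · exact mul_nonneg (by linarith) h1
    · exact le_rfl
    · exact mul_nonneg (by linarith) (by linarith)
    · exact le_rfl
    · positivity
    · exact le_rfl

theorem sum_selProb [∀ i, Fintype (A i)] (hC : ∀ i a, 3 ≤ (C i a).card)
    (a0 a1 : ∀ i, A i) (i : ι) : ∑ x, selProb κ U C ε a0 a1 i x = 1 := by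
  have h1 : (((C i (a1 i)).erase (a1 i)).card : ℝ) ≠ 0 :=
    Nat.cast_ne_zero.2 (card_erase_pos C hC i (a1 i)).ne'
  have h2 : ((((C i (a1 i)).erase (a1 i)).erase (a0 i)).card : ℝ) ≠ 0 :=
    Nat.cast_ne_zero.2 (card_erase_erase_pos C hC i (a1 i) (a0 i)).ne'
  unfold selProb
  by_cases h : U i a0 ≤ U i a1
  · simp only [if_pos h, Finset.sum_add_distrib, Finset.sum_ite_eq', Finset.sum_ite_mem,
      Finset.mem_univ, if_true, Finset.univ_inter, Finset.sum_const, nsmul_eq_mul]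
    field_simp
    ring
  · simp only [if_neg h, Finset.sum_add_distrib, Finset.sum_ite_eq', Finset.sum_ite_mem,
      Finset.mem_univ, if_true, Finset.univ_inter, Finset.sum_const, nsmul_eq_mul]
    field_simp
    ring

theorem selProb_eq_zero {a0 a1 : ∀ i, A i} {i : ι} {x : A i} (h0 : x ≠ a0 i) (h1 : x ≠ a1 i)
    (hx : x ∉ C i (a1 i)) : selProb κ U C ε a0 a1 i x = 0 := by
  simp [selProb, h0, h1, hx]

theorem div_card_le {B : Type*} (hε0 : 0 < ε) (s : Finset B) : ε / s.card ≤ ε := by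
  rcases s.card.eq_zero_or_pos with h | h
  · simp [h, hε0.le]
  · exact div_le_self hε0.le (by exact_mod_cast h)

theorem selProb_le (hκ0 : 0 < κ) (hκ : κ ≤ 1 / 2) (hε0 : 0 < ε) (hε : ε ≤ 1 / 2)
    (a0 a1 : ∀ i, A i) (i : ι) (x : A i) :
    selProb κ U C ε a0 a1 i x ≤ ε ^ moveCost U a0 a1 i x := by
  unfold selProb moveCost
  by_cases h : U i a0 ≤ U i a1
  · simp only [if_pos h]
    by_cases h1 : x = a1 i
    · simp [h1, hε0.le]
    · simp only [h1, if_false, zero_add, Real.rpow_one]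
      split_ifs
      · exact div_card_le hε0 _
      · exact hε0.le
  · simp only [if_neg h]
    obtain ⟨k1, k2, k3⟩ := stay_weight_mem hκ0 hκ hε0 hε (d := U i a0 - U i a1) (by linarith)
    by_cases h0 : x = a0 i
    · subst h0
      by_cases h1 : a0 i = a1 i
      · simp only [h1, if_true, Real.rpow_zero, Finset.mem_erase, ne_eq, not_true_eq_false,
          false_and, if_false]
        nlinarith
      · simp only [h1, if_true, Real.rpow_zero, Finset.mem_erase, ne_eq, not_true_eq_false,
          false_and, if_false]
        nlinarith
    · by_cases h1 : x = a1 i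
      · subst h1
        simp only [h0, if_true, if_false, Finset.mem_erase, ne_eq, not_true_eq_false,
          false_and, and_false]
        nlinarith
      · simp only [h0, h1, if_false, zero_add, Real.rpow_one]
        split_ifs
        · exact div_card_le hε0 _
        · exact hε0.le

theorem div_card_le_div_card {B : Type*} [Fintype B] (hε0 : 0 < ε) {s : Finset B} {x : B}
    (hx : x ∈ s) : ε / Fintype.card B ≤ ε / s.card := by
  have : 0 < s.card := Finset.card_pos.2 ⟨x, hx⟩
  exact div_le_div_of_nonneg_left hε0.le (by exact_mod_cast this)
    (by exact_mod_cast Finset.card_le_univ s)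

theorem le_selProb_explore [∀ i, Fintype (A i)] (hε0 : 0 < ε)
    {a : ∀ i, A i} {i : ι} {x : A i} (hx : x ∈ C i (a i)) (hxa : x ≠ a i) :
    ε / Fintype.card (A i) ≤ selProb κ U C ε a a i x := by
  have hmem : x ∈ (C i (a i)).erase (a i) := Finset.mem_erase.2 ⟨hxa, hx⟩
  simpa [selProb, hxa, hx] using div_card_le_div_card hε0 hmem

theorem le_selProb_stay (hκ0 : 0 < κ) (hκ : κ ≤ 1 / 2) (hε0 : 0 < ε) (hε : ε ≤ 1 / 2)
    (a0 a1 : ∀ i, A i) (i : ι) :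
    κ / 2 * ε ^ max 0 (U i a0 - U i a1) ≤ selProb κ U C ε a0 a1 i (a1 i) := by
  unfold selProb
  by_cases h : U i a0 ≤ U i a1
  · rw [if_pos h, max_eq_left (by linarith)]
    simp
    linarith
  · rw [if_neg h, max_eq_right (by linarith)]
    obtain ⟨k1, k2, k3⟩ := stay_weight_mem hκ0 hκ hε0 hε (d := U i a0 - U i a1) (by linarith)
    have k4 : 0 ≤ (if a1 i = a0 i then (1 - ε) * (1 - κ * ε ^ (U i a0 - U i a1)) else 0) := by
      split_ifs
      · exact mul_nonneg (by linarith) (by linarith)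
      · exact le_rfl
    simp only [if_true, Finset.mem_erase, ne_eq, not_true_eq_false, false_and, and_false, if_false]
    nlinarith

theorem le_selProb_still (hκ : κ ≤ 1 / 2) (hε : ε ≤ 1 / 2)
    {a0 a1 : ∀ i, A i} {i : ι} (h : a0 i = a1 i) :
    κ / 2 ≤ selProb κ U C ε a0 a1 i (a1 i) := by
  unfold selProb
  split_ifs <;> simp_all <;> nlinarith

end Selection

section HalfLipschitz

variable {ι : Type*} [DecidableEq ι] {A : ι → Type*}

/-- `q` drops by at most `1 / 2` along a unilateral constrained deviation. -/
def HalfLipschitz (C : ∀ i, A i → Finset (A i)) (q : (∀ i, A i) → ℝ) : Prop :=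
  ∀ (i : ι) (a : ∀ j, A j) (x : A i), x ∈ C i (a i) → q a ≤ q (Function.update a i x) + 1 / 2

theorem HalfLipschitz.le_add_card {C : ∀ i, A i → Finset (A i)} {q : (∀ i, A i) → ℝ}
    (hq : HalfLipschitz C q) (s : Finset ι) :
    ∀ v w : ∀ i, A i, (∀ i ∉ s, w i = v i) → (∀ i ∈ s, w i ∈ C i (v i)) →
      q v ≤ q w + s.card / 2 := by
  induction s using Finset.induction_on with
  | empty =>
    intro v w h _
    have : w = v := funext fun i => h i (Finset.notMem_empty i)
    simp [this]
  | insert i s his ih =>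
    intro v w h h'
    have h1 := hq i v (w i) (h' i (Finset.mem_insert_self i s))
    have h2 := ih (Function.update v i (w i)) w
      (fun j hj => by
        by_cases hji : j = i
        · subst hji; simp
        · rw [Function.update_of_ne hji]
          exact h j (by simp [hj, hji]))
      (fun j hj => by
        rw [Function.update_of_ne (fun hji : j = i => his (hji ▸ hj))]
        exact h' j (Finset.mem_insert_of_mem hj))
    rw [Finset.card_insert_of_notMem his]
    push_cast
    linarith

end HalfLipschitz

section Joint

variable {ι : Type*} [Fintype ι] {A : ι → Type*}
  (κ : ℝ) (U : ι → (∀ i, A i) → ℝ) (C : ∀ i, A i → Finset (A i)) (ε : ℝ)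

/-- The probability that the joint action `w` is selected in state `z`. -/
noncomputable def jointProb (z : (∀ i, A i) × (∀ i, A i)) (w : ∀ i, A i) : ℝ :=
  ∏ i, selProb κ U C ε z.1 z.2 i (w i)

/-- The players selecting an action that is absent from the state `z`. -/
noncomputable def fresh (z : (∀ i, A i) × (∀ i, A i)) (w : ∀ i, A i) : Finset ι :=
  Finset.univ.filter fun i => w i ≠ z.1 i ∧ w i ≠ z.2 i

/-- A rank which decreases along greedy steps outside the diagonal. -/
noncomputable def stateRank (z : (∀ i, A i) × (∀ i, A i)) : ℕ :=
  2 * (Finset.univ.filter fun i => z.1 i ≠ z.2 i).card +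
    if ∀ i, z.1 i ≠ z.2 i → U i z.2 < U i z.1 then 1 else 0

variable {κ ε}

theorem jointProb_nonneg (hκ0 : 0 < κ) (hκ : κ ≤ 1 / 2) (hε0 : 0 < ε) (hε : ε ≤ 1 / 2)
    (z : (∀ i, A i) × (∀ i, A i)) (w : ∀ i, A i) : 0 ≤ jointProb κ U C ε z w :=
  Finset.prod_nonneg fun _ _ => selProb_nonneg U C hκ0 hκ hε0 hε _ _ _ _

theorem jointProb_le (hκ0 : 0 < κ) (hκ : κ ≤ 1 / 2) (hε0 : 0 < ε) (hε : ε ≤ 1 / 2)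
    (z : (∀ i, A i) × (∀ i, A i)) (w : ∀ i, A i) :
    jointProb κ U C ε z w ≤ ε ^ ∑ i, moveCost U z.1 z.2 i (w i) := by
  rw [Real.rpow_sum_of_pos hε0]
  exact Finset.prod_le_prod (fun _ _ => selProb_nonneg U C hκ0 hκ hε0 hε _ _ _ _)
    fun _ _ => selProb_le U C hκ0 hκ hε0 hε _ _ _ _

theorem jointProb_le_one (hκ0 : 0 < κ) (hκ : κ ≤ 1 / 2) (hε0 : 0 < ε) (hε : ε ≤ 1 / 2)
    (z : (∀ i, A i) × (∀ i, A i)) (w : ∀ i, A i) : jointProb κ U C ε z w ≤ 1 :=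
  (jointProb_le U C hκ0 hκ hε0 hε z w).trans <| Real.rpow_le_one hε0.le (by linarith) <|
    Finset.sum_nonneg fun _ _ => moveCost_nonneg U _ _ _ _

theorem jointProb_eq_zero {z : (∀ i, A i) × (∀ i, A i)} {w : ∀ i, A i}
    (h : ¬ ∀ i, w i = z.1 i ∨ w i = z.2 i ∨ w i ∈ C i (z.2 i)) :
    jointProb κ U C ε z w = 0 := by
  push Not at h
  obtain ⟨i, h0, h1, h2⟩ := h
  exact Finset.prod_eq_zero (Finset.mem_univ i) (selProb_eq_zero U C h0 h1 h2)

theorem half_card_fresh (z : (∀ i, A i) × (∀ i, A i)) (w : ∀ i, A i) :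
    ((fresh z w).card : ℝ) / 2 = ∑ i, if w i ≠ z.1 i ∧ w i ≠ z.2 i then (1 : ℝ) / 2 else 0 := by
  rw [← Finset.sum_filter, Finset.sum_const, nsmul_eq_mul, fresh]
  ring

theorem half_card_fresh_add_le {z : (∀ i, A i) × (∀ i, A i)} {w : ∀ i, A i} {e : ℝ} {i : ι}
    (hi : (if w i ≠ z.1 i ∧ w i ≠ z.2 i then (1 : ℝ) / 2 else 0) + e ≤
      moveCost U z.1 z.2 i (w i)) :
    e + (fresh z w).card / 2 ≤ ∑ i, moveCost U z.1 z.2 i (w i) := by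
  rw [half_card_fresh, ← Finset.add_sum_erase _ _ (Finset.mem_univ i),
    ← Finset.add_sum_erase Finset.univ (fun i => moveCost U z.1 z.2 i (w i)) (Finset.mem_univ i),
    ← add_assoc, add_comm e]
  exact add_le_add hi (Finset.sum_le_sum fun j _ => moveCost_ge_half U _ _ _ _)

theorem half_card_fresh_le (z : (∀ i, A i) × (∀ i, A i)) (w : ∀ i, A i) :
    ((fresh z w).card : ℝ) / 2 ≤ ∑ i, moveCost U z.1 z.2 i (w i) := by
  rw [half_card_fresh]
  exact Finset.sum_le_sum fun j _ => moveCost_ge_half U _ _ _ _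

theorem half_card_fresh_add_half_le {z : (∀ i, A i) × (∀ i, A i)} {w : ∀ i, A i} {i : ι}
    (hi : moveCost U z.1 z.2 i (w i) = 1) :
    1 / 2 + ((fresh z w).card : ℝ) / 2 ≤ ∑ i, moveCost U z.1 z.2 i (w i) := by
  refine half_card_fresh_add_le U (i := i) ?_
  rw [hi]
  split_ifs <;> norm_num

theorem half_card_fresh_add_le_of_ne_greedy {δ : ℝ} (hδ : δ ≤ 1 / 2)
    (hδU : ∀ i a b, U i b < U i a → δ ≤ U i a - U i b)
    {z : (∀ i, A i) × (∀ i, A i)} {w : ∀ i, A i} (hw : w ≠ greedy U z.1 z.2) :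
    δ + (fresh z w).card / 2 ≤ ∑ i, moveCost U z.1 z.2 i (w i) := by
  obtain ⟨i, hi⟩ := Function.ne_iff.1 hw
  exact half_card_fresh_add_le U (moveCost_ge_of_ne_greedy U hδ hδU hi)

theorem stateRank_le (z : (∀ i, A i) × (∀ i, A i)) : stateRank U z ≤ 2 * Fintype.card ι + 1 := by
  unfold stateRank
  have := Finset.card_le_univ (Finset.univ.filter fun i => z.1 i ≠ z.2 i)
  split_ifs <;> omega

theorem stateRank_greedy_lt {z : (∀ i, A i) × (∀ i, A i)} (hz : z.1 ≠ z.2) :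
    stateRank U (z.2, greedy U z.1 z.2) < stateRank U z := by
  obtain ⟨a0, a1⟩ := z
  dsimp only at hz ⊢
  let s := Finset.univ.filter fun i => a0 i ≠ a1 i
  let t := Finset.univ.filter fun i => a1 i ≠ greedy U a0 a1 i
  have hts : t ⊆ s := fun i hi => by
    simp only [t, s, greedy, Finset.mem_filter_univ, ne_eq, left_eq_ite_iff, not_le,
      Classical.not_imp] at hi ⊢
    exact fun h => hi.2 h.symm
  have hs : s.Nonempty := by
    obtain ⟨i, hi⟩ := Function.ne_iff.1 hz
    exact ⟨i, by simpa [s] using hi⟩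
  have hr0 : stateRank U (a0, a1) = 2 * s.card +
    if ∀ i, a0 i ≠ a1 i → U i a1 < U i a0 then 1 else 0 := rfl
  have hr1 : stateRank U (a1, greedy U a0 a1) = 2 * t.card +
    if ∀ i, a1 i ≠ greedy U a0 a1 i → U i (greedy U a0 a1) < U i a1 then 1 else 0 := rfl
  rw [hr0, hr1]
  by_cases hst : t = s
  · have hall : ∀ i, a0 i ≠ a1 i → U i a1 < U i a0 := fun i hi => by
      have : i ∈ t := hst ▸ (by simpa [s] using hi)
      simp only [t, greedy, Finset.mem_filter_univ, ne_eq, left_eq_ite_iff, not_le,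
        Classical.not_imp] at this
      exact this.1
    have hg : greedy U a0 a1 = a0 := funext fun i => by
      by_cases hi : a0 i = a1 i
      · simp [greedy, hi]
      · simp [greedy, not_le.2 (hall i hi)]
    have hnot : ¬ ∀ i, a1 i ≠ greedy U a0 a1 i → U i (greedy U a0 a1) < U i a1 := by
      intro hcon
      obtain ⟨i, hi⟩ := hs
      have hi' : a0 i ≠ a1 i := by simpa [s] using hi
      rw [hg] at hcon
      exact lt_asymm (hall i hi') (hcon i hi'.symm)
    rw [if_pos hall, if_neg hnot, hst]
    omega
  · have hlt : t.card < s.card := Finset.card_lt_card (hts.ssubset_of_ne hst)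
    split_ifs <;> omega

variable [DecidableEq ι]

variable [∀ i, Fintype (A i)]

/-- The minimum of `q` over the joint actions mixing the two components of `z`. -/
noncomputable def mixMin (q : (∀ i, A i) → ℝ) (z : (∀ i, A i) × (∀ i, A i)) : ℝ :=
  (Finset.univ.filter fun v : ∀ i, A i => ∀ i, v i = z.1 i ∨ v i = z.2 i).inf'
    ⟨z.1, by simp⟩ q

theorem sum_phTrans_mul (z : (∀ i, A i) × (∀ i, A i)) (f : (∀ i, A i) × (∀ i, A i) → ℝ) :
    ∑ z', phTrans κ U C ε z z' * f z' = ∑ w, jointProb κ U C ε z w * f (z.2, w) := by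
  rw [Fintype.sum_prod_type, Finset.sum_eq_single z.2]
  · simp [phTrans, jointProb]
  · intro b _ hb
    simp [phTrans, hb]
  · simp

theorem sum_jointProb (hC : ∀ i a, 3 ≤ (C i a).card) (z : (∀ i, A i) × (∀ i, A i)) :
    ∑ w, jointProb κ U C ε z w = 1 := by
  have := Finset.prod_univ_sum (fun i => (Finset.univ : Finset (A i)))
    fun i x => selProb κ U C ε z.1 z.2 i x
  rw [Fintype.piFinset_univ] at this
  simp only [jointProb]
  rw [← this]
  exact Finset.prod_eq_one fun i _ => sum_selProb U C hC _ _ _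

variable {C}

theorem mixMin_le {q : (∀ i, A i) → ℝ} {z : (∀ i, A i) × (∀ i, A i)} {v : ∀ i, A i}
    (hv : ∀ i, v i = z.1 i ∨ v i = z.2 i) : mixMin q z ≤ q v :=
  Finset.inf'_le _ (by simpa using hv)

theorem exists_mixMin_eq (q : (∀ i, A i) → ℝ) (z : (∀ i, A i) × (∀ i, A i)) :
    ∃ v : ∀ i, A i, (∀ i, v i = z.1 i ∨ v i = z.2 i) ∧ mixMin q z = q v := by
  obtain ⟨v, hv, h⟩ := Finset.exists_mem_eq_inf' (s := Finset.univ.filter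
    fun v : ∀ i, A i => ∀ i, v i = z.1 i ∨ v i = z.2 i) ⟨z.1, by simp⟩ q
  exact ⟨v, by simpa using hv, h⟩

theorem mixMin_diag (q : (∀ i, A i) → ℝ) (a : ∀ i, A i) : mixMin q (a, a) = q a := by
  obtain ⟨v, hv, h⟩ := exists_mixMin_eq q (a, a)
  rw [h]
  congr 1
  exact funext fun i => by simpa using hv i

theorem HalfLipschitz.mixMin_le {q : (∀ i, A i) → ℝ} (hq : HalfLipschitz C q)
    {z : (∀ i, A i) × (∀ i, A i)} {w : ∀ i, A i}
    (h : ∀ i, w i = z.1 i ∨ w i = z.2 i ∨ w i ∈ C i (z.2 i)) :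
    mixMin q z ≤ mixMin q (z.2, w) + (fresh z w).card / 2 := by
  obtain ⟨v, hv, hqv⟩ := exists_mixMin_eq q (z.2, w)
  let s := Finset.univ.filter fun i => v i ≠ z.1 i ∧ v i ≠ z.2 i
  have hvw : ∀ i ∈ s, v i = w i := fun i hi =>
    (hv i).resolve_left (Finset.mem_filter.1 hi).2.2
  have hs : s ⊆ fresh z w := fun i hi => by
    have := hvw i hi
    have hi' := (Finset.mem_filter.1 hi).2
    exact Finset.mem_filter.2 ⟨Finset.mem_univ i, this ▸ hi'⟩
  let u : ∀ i, A i := fun i => if i ∈ s then z.2 i else v i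
  have hu : mixMin q z ≤ q u := by
    refine _root_.mixMin_le fun i => ?_
    by_cases hi : i ∈ s
    · simp [u, hi]
    · simp only [u, hi, if_false]
      by_contra hcon
      push Not at hcon
      exact hi (Finset.mem_filter.2 ⟨Finset.mem_univ i, hcon⟩)
  have huv := hq.le_add_card s u v (fun i hi => by simp [u, hi]) (fun i hi => by
    have h1 := hvw i hi
    have h2 := (Finset.mem_filter.1 hi).2
    simp only [u, hi, if_true]
    rw [h1] at h2 ⊢
    exact ((h i).resolve_left h2.1).resolve_left h2.2)
  have hc : (s.card : ℝ) ≤ (fresh z w).card := by exact_mod_cast Finset.card_le_card hs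
  linarith

theorem HalfLipschitz.jointProb_mul_rpow_le {q : (∀ i, A i) → ℝ} (hq : HalfLipschitz C q)
    (hκ0 : 0 < κ) (hκ : κ ≤ 1 / 2) (hε0 : 0 < ε) (hε : ε ≤ 1 / 2)
    {z : (∀ i, A i) × (∀ i, A i)} {w : ∀ i, A i} {e : ℝ}
    (he : e + (fresh z w).card / 2 ≤ ∑ i, moveCost U z.1 z.2 i (w i)) :
    jointProb κ U C ε z w * ε ^ mixMin q (z.2, w) ≤ ε ^ (e + mixMin q z) := by
  by_cases h : ∀ i, w i = z.1 i ∨ w i = z.2 i ∨ w i ∈ C i (z.2 i)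
  · calc jointProb κ U C ε z w * ε ^ mixMin q (z.2, w)
        ≤ ε ^ (∑ i, moveCost U z.1 z.2 i (w i)) * ε ^ mixMin q (z.2, w) :=
          mul_le_mul_of_nonneg_right (jointProb_le U C hκ0 hκ hε0 hε z w) (by positivity)
      _ = ε ^ (∑ i, moveCost U z.1 z.2 i (w i) + mixMin q (z.2, w)) :=
          (Real.rpow_add hε0 _ _).symm
      _ ≤ ε ^ (e + mixMin q z) := by
          refine Real.rpow_le_rpow_of_exponent_ge hε0 (by linarith) ?_
          have := hq.mixMin_le h
          linarith
  · rw [jointProb_eq_zero U C h, zero_mul]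
    positivity

end Joint

section Estimates

variable {ι : Type*} [Fintype ι] [DecidableEq ι] {A : ι → Type*} [∀ i, Fintype (A i)]
  {κ : ℝ} {U : ι → (∀ i, A i) → ℝ} {C : ∀ i, A i → Finset (A i)} {ε δ K : ℝ}
  {q : (∀ i, A i) → ℝ} {f : (∀ i, A i) × (∀ i, A i) → ℝ}

theorem sum_mul_le_greedy_add (hκ0 : 0 < κ) (hκ : κ ≤ 1 / 2) (hε0 : 0 < ε) (hε : ε ≤ 1 / 2)
    (hδ : δ ≤ 1 / 2) (hδU : ∀ i a b, U i b < U i a → δ ≤ U i a - U i b)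
    (hq : HalfLipschitz C q) (hK : 0 ≤ K) {r : (∀ i, A i) × (∀ i, A i) → ℝ}
    (hr0 : ∀ z, 0 ≤ r z) (hr : ∀ z, r z ≤ K) (z : (∀ i, A i) × (∀ i, A i)) :
    ∑ w, jointProb κ U C ε z w * (r (z.2, w) * ε ^ mixMin q (z.2, w)) ≤
      (r (z.2, greedy U z.1 z.2) + Fintype.card (∀ i, A i) * K * ε ^ δ) * ε ^ mixMin q z := by
  rw [← Finset.add_sum_erase _ _ (Finset.mem_univ (greedy U z.1 z.2)), add_mul]
  refine add_le_add ?_ ?_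
  · have h := hq.jointProb_mul_rpow_le U hκ0 hκ hε0 hε (z := z) (w := greedy U z.1 z.2) (e := 0)
      (by simpa using half_card_fresh_le U z (greedy U z.1 z.2))
    rw [zero_add] at h
    calc _ = r (z.2, greedy U z.1 z.2) * (jointProb κ U C ε z (greedy U z.1 z.2) *
          ε ^ mixMin q (z.2, greedy U z.1 z.2)) := by ring
      _ ≤ _ := mul_le_mul_of_nonneg_left h (hr0 _)
  · have hterm : ∀ w ∈ Finset.univ.erase (greedy U z.1 z.2),
        jointProb κ U C ε z w * (r (z.2, w) * ε ^ mixMin q (z.2, w)) ≤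
          K * ε ^ δ * ε ^ mixMin q z := by
      intro w hw
      have h := hq.jointProb_mul_rpow_le U hκ0 hκ hε0 hε (z := z) (w := w)
        (half_card_fresh_add_le_of_ne_greedy U hδ hδU (Finset.ne_of_mem_erase hw))
      calc _ = r (z.2, w) * (jointProb κ U C ε z w * ε ^ mixMin q (z.2, w)) := by ring
        _ ≤ K * ε ^ (δ + mixMin q z) := mul_le_mul (hr _) h
            (mul_nonneg (jointProb_nonneg U C hκ0 hκ hε0 hε _ _) (by positivity)) hK
        _ = _ := by rw [Real.rpow_add hε0]; ring
    refine (Finset.sum_le_card_nsmul _ _ _ hterm).trans ?_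
    rw [nsmul_eq_mul]
    have hcard : ((Finset.univ.erase (greedy U z.1 z.2)).card : ℝ) ≤
        Fintype.card (∀ i, A i) := by exact_mod_cast Finset.card_le_univ _
    calc _ ≤ (Fintype.card (∀ i, A i) : ℝ) * (K * ε ^ δ * ε ^ mixMin q z) :=
          mul_le_mul_of_nonneg_right hcard (by positivity)
      _ = _ := by ring

theorem sum_explore_le (hκ0 : 0 < κ) (hκ : κ ≤ 1 / 2) (hε0 : 0 < ε) (hε : ε ≤ 1 / 2)
    (hq : HalfLipschitz C q) (hK : 0 ≤ K) (hf : ∀ z, f z ≤ K * ε ^ mixMin q z)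
    (z : (∀ i, A i) × (∀ i, A i)) (s : Finset (∀ i, A i))
    (hs : ∀ w ∈ s, ∃ i, moveCost U z.1 z.2 i (w i) = 1) :
    ∑ w ∈ s, jointProb κ U C ε z w * f (z.2, w) ≤
      Fintype.card (∀ i, A i) * K * ε ^ (1 / 2 + mixMin q z) := by
  have hterm : ∀ w ∈ s, jointProb κ U C ε z w * f (z.2, w) ≤
      K * ε ^ (1 / 2 + mixMin q z) := by
    intro w hw
    obtain ⟨i, hi⟩ := hs w hw
    have h := hq.jointProb_mul_rpow_le U hκ0 hκ hε0 hε (z := z) (w := w)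
      (half_card_fresh_add_half_le U hi)
    calc _ ≤ jointProb κ U C ε z w * (K * ε ^ mixMin q (z.2, w)) :=
          mul_le_mul_of_nonneg_left (hf _) (jointProb_nonneg U C hκ0 hκ hε0 hε _ _)
      _ = K * (jointProb κ U C ε z w * ε ^ mixMin q (z.2, w)) := by ring
      _ ≤ _ := mul_le_mul_of_nonneg_left h hK
  refine (Finset.sum_le_card_nsmul _ _ _ hterm).trans ?_
  rw [nsmul_eq_mul, mul_assoc]
  exact mul_le_mul_of_nonneg_right (by exact_mod_cast Finset.card_le_univ _) (by positivity)

theorem exists_moveCost_eq_one {ι : Type*} {A : ι → Type*} {U : ι → (∀ i, A i) → ℝ}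
    {a0 a1 w : ∀ i, A i} (h : ∀ i, a0 i ≠ a1 i → U i a0 ≤ U i a1) (hw : w ≠ a1) :
    ∃ i, moveCost U a0 a1 i (w i) = 1 := by
  obtain ⟨i, hi⟩ := Function.ne_iff.1 hw
  refine ⟨i, ?_⟩
  by_cases hi' : a0 i = a1 i
  · exact moveCost_of_explore U (hi'.symm ▸ hi) hi
  · simp [moveCost, h i hi', hi]

theorem le_settled (hκ0 : 0 < κ) (hκ : κ ≤ 1 / 2) (hε0 : 0 < ε) (hε : ε ≤ 1 / 2)
    (hq : HalfLipschitz C q) (hK : 0 ≤ K) (hf : ∀ z, f z ≤ K * ε ^ mixMin q z)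
    {z : (∀ i, A i) × (∀ i, A i)} (hz : f z = ∑ w, jointProb κ U C ε z w * f (z.2, w))
    (h : ∀ i, z.1 i ≠ z.2 i → U i z.1 ≤ U i z.2) :
    f z ≤ jointProb κ U C ε z z.2 * f (z.2, z.2) +
      Fintype.card (∀ i, A i) * K * ε ^ (1 / 2 + mixMin q z) := by
  rw [hz, ← Finset.add_sum_erase _ _ (Finset.mem_univ z.2)]
  exact add_le_add_right (sum_explore_le hκ0 hκ hε0 hε hq hK hf z _ fun w hw =>
    exists_moveCost_eq_one h (Finset.ne_of_mem_erase hw)) _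

theorem mixMin_swap (a b : ∀ i, A i) : mixMin q (a, b) = mixMin q (b, a) := by
  refine le_antisymm ?_ ?_
  · obtain ⟨v, hv, h⟩ := exists_mixMin_eq q (b, a)
    exact h ▸ mixMin_le fun i => (hv i).symm
  · obtain ⟨v, hv, h⟩ := exists_mixMin_eq q (a, b)
    exact h ▸ mixMin_le fun i => (hv i).symm

theorem HalfLipschitz.le_mixMin_update (hq : HalfLipschitz C q) {b : ∀ i, A i} {i : ι} {x : A i}
    (hx : x ∈ C i (b i)) : q b ≤ 1 / 2 + mixMin q (b, Function.update b i x) := by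
  obtain ⟨v, hv, h⟩ := exists_mixMin_eq q (b, Function.update b i x)
  have hne : ∀ j, j ≠ i → v j = b j := fun j hj => by
    simpa [Function.update_of_ne hj] using hv j
  rw [h]
  rcases hv i with hi | hi
  · have : v = b := funext fun j => by
      by_cases hj : j = i
      · subst hj; exact hi
      · exact hne j hj
    rw [this]
    linarith
  · have : v = Function.update b i x := Function.eq_update_iff.2
      ⟨by simpa using hi, hne⟩
    rw [this, add_comm]
    exact hq i b x hx

variable {φ : (∀ i, A i) → ℝ} {S : Set (∀ i, A i)}

theorem max_drop_le_moveCost {ι : Type*} [DecidableEq ι] {A : ι → Type*}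
    {U : ι → (∀ i, A i) → ℝ} {C : ∀ i, A i → Finset (A i)} {φ : (∀ i, A i) → ℝ}
    (hpot : IsPotentialGame U C φ) {b : ∀ i, A i} {i : ι} {x : A i}
    (hx : x ∈ C i (b i)) (hxb : x ≠ b i) :
    max 0 (φ b - φ (Function.update b i x)) ≤
      moveCost U b (Function.update b i x) i (Function.update b i x i) := by
  have h := hpot i b x hx
  simp only [moveCost, Function.update_self, if_true, hxb, if_false]
  split_ifs
  · exact max_le le_rfl (by linarith)
  · exact max_le (by linarith) (by linarith)

theorem jointProb_stay_mul_le {ι : Type*} [Fintype ι] [DecidableEq ι] {A : ι → Type*}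
    {κ ε : ℝ} {U : ι → (∀ i, A i) → ℝ} {C : ∀ i, A i → Finset (A i)} {φ q : (∀ i, A i) → ℝ}
    {f : (∀ i, A i) × (∀ i, A i) → ℝ} {S : Set (∀ i, A i)}
    (hκ0 : 0 < κ) (hκ : κ ≤ 1 / 2) (hε0 : 0 < ε) (hε : ε ≤ 1 / 2)
    (hpot : IsPotentialGame U C φ) (hf1 : ∀ z, f z ≤ 1) (hfD : ∀ b ∉ S, f (b, b) = 0)
    {b : ∀ i, A i} {i : ι} {x : A i} (hx : x ∈ C i (b i)) (hxb : x ≠ b i)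
    (hqS : Function.update b i x ∈ S → q b ≤ max 0 (φ b - φ (Function.update b i x))) :
    jointProb κ U C ε (b, Function.update b i x) (Function.update b i x) *
      f (Function.update b i x, Function.update b i x) ≤ ε ^ q b := by
  by_cases hS : Function.update b i x ∈ S
  · have h1 := jointProb_le U C hκ0 hκ hε0 hε (b, Function.update b i x) (Function.update b i x)
    have h2 := Finset.single_le_sum (f := fun j => moveCost U b (Function.update b i x) j
      (Function.update b i x j)) (fun j _ => moveCost_nonneg U _ _ _ _) (Finset.mem_univ i)
    have h3 := max_drop_le_moveCost hpot hx hxb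
    calc _ ≤ jointProb κ U C ε (b, Function.update b i x) (Function.update b i x) :=
          mul_le_of_le_one_right (jointProb_nonneg U C hκ0 hκ hε0 hε _ _) (hf1 _)
      _ ≤ _ := h1
      _ ≤ _ := Real.rpow_le_rpow_of_exponent_ge hε0 (by linarith)
          (((hqS hS).trans h3).trans h2)
  · rw [hfD _ hS, mul_zero]
    positivity

theorem le_of_single_deviation (hκ0 : 0 < κ) (hκ : κ ≤ 1 / 2) (hε0 : 0 < ε) (hε : ε ≤ 1 / 2)
    (hq : HalfLipschitz C q) (hK : 0 ≤ K) (hf : ∀ z, f z ≤ K * ε ^ mixMin q z)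
    (hf0 : ∀ z, 0 ≤ f z)
    (hfN : ∀ z, z.1 ≠ z.2 → f z = ∑ w, jointProb κ U C ε z w * f (z.2, w))
    (hpot : IsPotentialGame U C φ) (hf1 : ∀ z, f z ≤ 1) (hfD : ∀ b ∉ S, f (b, b) = 0)
    {b : ∀ i, A i} (hb : b ∉ S) {i : ι} {x : A i} (hx : x ∈ C i (b i)) (hxb : x ≠ b i)
    (hqS : Function.update b i x ∈ S → q b ≤ max 0 (φ b - φ (Function.update b i x))) :
    f (b, Function.update b i x) ≤ (1 + 2 * (Fintype.card (∀ i, A i) * K)) * ε ^ q b := by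
  have hstay := jointProb_stay_mul_le (κ := κ) hκ0 hκ hε0 hε hpot hf1 hfD hx hxb hqS
  have hmix := hq.le_mixMin_update hx
  set c := Function.update b i x with hc
  have hci : c i = x := by simp [hc]
  have hcj : ∀ j, j ≠ i → c j = b j := fun j hj => by simp [hc, hj]
  have hbc : b ≠ c := fun h => hxb (by rw [← hci, ← h])
  have hNK : 0 ≤ (Fintype.card (∀ i, A i) : ℝ) * K := by positivity
  have hrpow : (Fintype.card (∀ i, A i) : ℝ) * K * ε ^ (1 / 2 + mixMin q (b, c)) ≤
      Fintype.card (∀ i, A i) * K * ε ^ q b :=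
    mul_le_mul_of_nonneg_left (Real.rpow_le_rpow_of_exponent_ge hε0 (by linarith) hmix) hNK
  have hpos : 0 ≤ (Fintype.card (∀ i, A i) : ℝ) * K * ε ^ q b := by positivity
  have honly : ∀ j, b j ≠ c j → j = i := fun j hj => by
    by_contra hji
    exact hj (hcj j hji).symm
  by_cases hU : U i b ≤ U i c
  · have h := le_settled hκ0 hκ hε0 hε hq hK hf (hfN (b, c) hbc)
      (fun j hj => honly j hj ▸ hU)
    dsimp only at h
    linarith
  · have hback : f (c, b) ≤ Fintype.card (∀ i, A i) * K * ε ^ q b := by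
      have h := le_settled hκ0 hκ hε0 hε hq hK hf (hfN (c, b) hbc.symm)
        (fun j hj => honly j hj.symm ▸ (not_le.1 hU).le)
      dsimp only at h
      rw [hfD b hb, mul_zero, zero_add, mixMin_swap] at h
      exact h.trans hrpow
    have hexp := sum_explore_le (U := U) hκ0 hκ hε0 hε hq hK hf (b, c)
      ((Finset.univ.erase c).erase b) (fun w hw => by
        simp only [Finset.mem_erase, Finset.mem_univ, and_true] at hw
        by_cases hex : ∃ j, j ≠ i ∧ w j ≠ b j
        · obtain ⟨j, hj, hwj⟩ := hex
          exact ⟨j, moveCost_of_explore U hwj (by change w j ≠ c j; rw [hcj j hj]; exact hwj)⟩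
        · push Not at hex
          refine ⟨i, moveCost_of_explore U (fun h => hw.1 ?_) (fun h => hw.2 ?_)⟩
          · funext j
            by_cases hj : j = i
            · subst hj; exact h
            · exact hex j hj
          · funext j
            by_cases hj : j = i
            · subst hj; exact h
            · rw [hcj j hj]; exact hex j hj)
    have hb' : b ∈ Finset.univ.erase c := Finset.mem_erase.2 ⟨hbc, Finset.mem_univ b⟩
    have hsum := hfN (b, c) hbc
    rw [← Finset.add_sum_erase _ _ (Finset.mem_univ c), ← Finset.add_sum_erase _ _ hb'] at hsum
    have hle : jointProb κ U C ε (b, c) b * f (c, b) ≤ f (c, b) :=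
      mul_le_of_le_one_left (hf0 _) (jointProb_le_one U C hκ0 hκ hε0 hε _ _)
    dsimp only at hsum hexp
    linarith

theorem card_fresh_le {ι : Type*} [Fintype ι] {A : ι → Type*} (U : ι → (∀ i, A i) → ℝ)
    (z : (∀ i, A i) × (∀ i, A i)) (w : ∀ i, A i) :
    ((fresh z w).card : ℝ) ≤ ∑ i, moveCost U z.1 z.2 i (w i) := by
  have : ((fresh z w).card : ℝ) = ∑ i ∈ fresh z w, moveCost U z.1 z.2 i (w i) := by
    rw [Finset.sum_congr rfl fun i hi => moveCost_of_explore U (Finset.mem_filter.1 hi).2.1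
      (Finset.mem_filter.1 hi).2.2]
    simp
  rw [this]
  exact Finset.sum_le_univ_sum_of_nonneg fun i => moveCost_nonneg U _ _ _ _

theorem escape_le (hκ0 : 0 < κ) (hκ : κ ≤ 1 / 2) (hε0 : 0 < ε) (hε : ε ≤ 1 / 2)
    (hq : HalfLipschitz C q) (hK : 0 ≤ K) (hf : ∀ z, f z ≤ K * ε ^ mixMin q z)
    (hf0 : ∀ z, 0 ≤ f z)
    (hfN : ∀ z, z.1 ≠ z.2 → f z = ∑ w, jointProb κ U C ε z w * f (z.2, w))
    (hpot : IsPotentialGame U C φ) (hf1 : ∀ z, f z ≤ 1) (hfD : ∀ b ∉ S, f (b, b) = 0)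
    {b : ∀ i, A i} (hb : b ∉ S)
    (hqS : ∀ i, ∀ x ∈ C i (b i), Function.update b i x ∈ S →
      q b ≤ max 0 (φ b - φ (Function.update b i x))) :
    ∑ w, jointProb κ U C ε (b, b) w * f (b, w) ≤
      Fintype.card (∀ i, A i) * (1 + 2 * (Fintype.card (∀ i, A i) * K)) * ε ^ (1 + q b) := by
  set G := 1 + 2 * (Fintype.card (∀ i, A i) * K) with hG
  have hN : (1 : ℝ) ≤ Fintype.card (∀ i, A i) := by
    exact_mod_cast Fintype.card_pos_iff.2 ⟨b⟩
  have hKG : K ≤ G := by nlinarith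
  have hG0 : 0 ≤ G := hK.trans hKG
  have hterm : ∀ w ∈ (Finset.univ : Finset (∀ i, A i)),
      jointProb κ U C ε (b, b) w * f (b, w) ≤ G * ε ^ (1 + q b) := by
    intro w _
    by_cases hsupp : ∀ i, w i = b i ∨ w i = b i ∨ w i ∈ C i (b i)
    swap
    · rw [jointProb_eq_zero U C (z := (b, b)) hsupp, zero_mul]
      positivity
    have hcost := card_fresh_le U (b, b) w
    have hp0 := jointProb_nonneg U C hκ0 hκ hε0 hε (b, b) w
    rcases Nat.lt_trichotomy (fresh (b, b) w).card 1 with h0 | h1 | h2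
    · have hwb : w = b := by
        have hempty : fresh (b, b) w = ∅ := Finset.card_eq_zero.1 (by omega)
        funext i
        by_contra hi
        have : i ∈ fresh (b, b) w := by simpa [fresh] using hi
        simp [hempty] at this
      rw [hwb, hfD b hb, mul_zero]
      positivity
    · obtain ⟨i, hi⟩ := Finset.card_eq_one.1 h1
      have hmem : ∀ j, w j ≠ b j ↔ j = i := fun j => by
        have : j ∈ fresh (b, b) w ↔ j = i := by rw [hi, Finset.mem_singleton]
        simpa [fresh] using this
      have hwi : w i ≠ b i := (hmem i).2 rfl
      have hwC : w i ∈ C i (b i) := ((hsupp i).resolve_left hwi).resolve_left hwi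
      have hw : w = Function.update b i (w i) := Function.eq_update_iff.2
        ⟨rfl, fun j hj => not_not.1 fun h => hj ((hmem j).1 h)⟩
      have hfw := le_of_single_deviation hκ0 hκ hε0 hε hq hK hf hf0 hfN hpot hf1 hfD hb hwC hwi
        (hqS i (w i) hwC)
      rw [← hw, ← hG] at hfw
      have hp : jointProb κ U C ε (b, b) w ≤ ε := by
        refine (jointProb_le U C hκ0 hκ hε0 hε (b, b) w).trans ?_
        conv_rhs => rw [← Real.rpow_one ε]
        refine Real.rpow_le_rpow_of_exponent_ge hε0 (by linarith) ?_
        rw [h1] at hcost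
        exact_mod_cast hcost
      calc _ ≤ ε * (G * ε ^ q b) := mul_le_mul hp hfw (hf0 _) hε0.le
        _ = G * ε ^ (1 + q b) := by rw [Real.rpow_add hε0, Real.rpow_one]; ring
    · have h := hq.jointProb_mul_rpow_le U hκ0 hκ hε0 hε (z := (b, b)) (w := w)
        (e := (fresh (b, b) w).card / 2) (by linarith)
      rw [mixMin_diag] at h
      have h2' : (2 : ℝ) ≤ (fresh (b, b) w).card := by exact_mod_cast h2
      calc _ ≤ jointProb κ U C ε (b, b) w * (K * ε ^ mixMin q (b, w)) :=
            mul_le_mul_of_nonneg_left (hf _) hp0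
        _ = K * (jointProb κ U C ε (b, b) w * ε ^ mixMin q (b, w)) := by ring
        _ ≤ K * ε ^ (1 + q b) := mul_le_mul_of_nonneg_left (h.trans
            (Real.rpow_le_rpow_of_exponent_ge hε0 (by linarith) (by linarith))) hK
        _ ≤ G * ε ^ (1 + q b) := mul_le_mul_of_nonneg_right hKG (by positivity)
  refine (Finset.sum_le_card_nsmul _ _ _ hterm).trans (le_of_eq ?_)
  rw [nsmul_eq_mul, Finset.card_univ, mul_assoc]

theorem prod_mul_le_prod_of_single {ι : Type*} [Fintype ι] [DecidableEq ι] {c p : ι → ℝ} {t : ℝ}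
    {i : ι} (hc : ∀ j, 0 ≤ c j) (ht : 0 ≤ t) (hi : c i * t ≤ p i) (hj : ∀ j ≠ i, c j ≤ p j) :
    (∏ j, c j) * t ≤ ∏ j, p j := by
  have : (∏ j, c j) * t = ∏ j, (c j * if j = i then t else 1) := by
    rw [Finset.prod_mul_distrib, Finset.prod_ite_eq' Finset.univ i]
    simp
  rw [this]
  refine Finset.prod_le_prod (fun j _ => mul_nonneg (hc j) (by split_ifs <;> simp [ht]))
    fun j _ => ?_
  by_cases h : j = i
  · subst h; simpa using hi
  · simpa [h] using hj j h

/-- A constant bounding the normalised probability of a unilateral deviation from below. -/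
noncomputable def deviationConst {ι : Type*} [Fintype ι] (κ : ℝ) (A : ι → Type*)
    [∀ i, Fintype (A i)] : ℝ := ∏ i, κ / 2 / Fintype.card (A i)

theorem half_div_card_le {B : Type*} [Fintype B] (hκ0 : 0 < κ) (b : B) :
    κ / 2 / Fintype.card B ≤ κ / 2 :=
  div_le_self (by positivity) (by exact_mod_cast Fintype.card_pos_iff.2 ⟨b⟩)

theorem le_one_sub_escape (hC : ∀ i a, 3 ≤ (C i a).card)
    (hκ0 : 0 < κ) (hκ : κ ≤ 1 / 2) (hε0 : 0 < ε) (hε : ε ≤ 1 / 2)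
    (hfN : ∀ z, z.1 ≠ z.2 → f z = ∑ w, jointProb κ U C ε z w * f (z.2, w))
    (hpot : IsPotentialGame U C φ) (hf1 : ∀ z, f z ≤ 1) (hfD : ∀ b ∉ S, f (b, b) = 0)
    {a : ∀ i, A i} {i : ι} {x : A i} (hx : x ∈ C i (a i)) (hxa : x ≠ a i)
    (hS : Function.update a i x ∉ S) :
    deviationConst κ A ^ 2 * ε ^ (1 + max 0 (φ a - φ (Function.update a i x))) ≤
      1 - ∑ w, jointProb κ U C ε (a, a) w * f (a, w) := by
  have hdrop : φ a - φ (Function.update a i x) = U i a - U i (Function.update a i x) := by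
    linarith [hpot i a x hx]
  rw [hdrop]
  have hfb := hfD _ hS
  set b := Function.update a i x with hb
  have hbi : b i = x := by simp [hb]
  have hbj : ∀ j, j ≠ i → b j = a j := fun j hj => by simp [hb, hj]
  have hab : a ≠ b := fun h => hxa (by rw [← hbi, ← h])
  have hc : ∀ j, 0 ≤ κ / 2 / Fintype.card (A j) := fun j => by positivity
  have hpart : ∀ (z : (∀ i, A i) × (∀ i, A i)) (w : ∀ i, A i),
      jointProb κ U C ε z w * (1 - f (z.2, w)) ≤
        1 - ∑ w, jointProb κ U C ε z w * f (z.2, w) := by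
    intro z w
    have h := Finset.single_le_sum (f := fun w => jointProb κ U C ε z w * (1 - f (z.2, w)))
      (fun w _ => mul_nonneg (jointProb_nonneg U C hκ0 hκ hε0 hε z w)
        (sub_nonneg.2 (hf1 (z.2, w)))) (Finset.mem_univ w)
    simpa [mul_sub, Finset.sum_sub_distrib, sum_jointProb U C hC] using h
  have h1 : deviationConst κ A * ε ≤ jointProb κ U C ε (a, a) b := by
    refine prod_mul_le_prod_of_single (i := i) hc hε0.le ?_ fun j hj => ?_
    · rw [hbi]
      refine le_trans ?_ (le_selProb_explore U C hε0 hx hxa)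
      rw [div_mul_eq_mul_div]
      gcongr
      nlinarith
    · rw [hbj j hj]
      exact (half_div_card_le hκ0 (a j)).trans (le_selProb_still U C hκ hε rfl)
  have h2 : deviationConst κ A * ε ^ max 0 (U i a - U i b) ≤ jointProb κ U C ε (a, b) b := by
    refine prod_mul_le_prod_of_single (i := i) hc (by positivity) ?_ fun j hj => ?_
    · refine le_trans ?_ (le_selProb_stay U C hκ0 hκ hε0 hε a b i)
      exact mul_le_mul_of_nonneg_right (half_div_card_le hκ0 x) (by positivity)
    · exact (half_div_card_le hκ0 (a j)).trans (le_selProb_still U C hκ hε (hbj j hj).symm)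
  have h3 := hpart (a, b) b
  dsimp only at h3
  rw [hfb, sub_zero, mul_one, ← hfN (a, b) hab] at h3
  have hc0 : 0 ≤ deviationConst κ A := Finset.prod_nonneg fun j _ => hc j
  calc _ = (deviationConst κ A * ε) * (deviationConst κ A * ε ^ max 0 (U i a - U i b)) := by
        rw [Real.rpow_add hε0, Real.rpow_one]; ring
    _ ≤ jointProb κ U C ε (a, a) b * (1 - f (a, b)) :=
        mul_le_mul h1 (h2.trans h3) (by positivity) (jointProb_nonneg U C hκ0 hκ hε0 hε _ _)
    _ ≤ _ := hpart (a, a) b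

end Estimates

section Game

variable {ι : Type*} {A : ι → Type*}
  {U : ι → (∀ i, A i) → ℝ} {C : ∀ i, A i → Finset (A i)} {φ : (∀ i, A i) → ℝ}

theorem exists_min_drop [Finite ι] [∀ i, Finite (A i)] (U : ι → (∀ i, A i) → ℝ) :
    ∃ δ : ℝ, 0 < δ ∧ δ ≤ 1 / 2 ∧ ∀ i a b, U i b < U i a → δ ≤ U i a - U i b := by
  have h : ∀ᶠ δ : ℝ in 𝓝[>] 0, ∀ p : ι × (∀ i, A i) × (∀ i, A i),
      U p.1 p.2.2 < U p.1 p.2.1 → δ ≤ U p.1 p.2.1 - U p.1 p.2.2 := by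
    refine eventually_all.2 fun p => ?_
    by_cases hp : U p.1 p.2.2 < U p.1 p.2.1
    · filter_upwards [Ioc_mem_nhdsGT (sub_pos.2 hp)] with δ hδ _ using hδ.2
    · exact Eventually.of_forall fun _ h => absurd h hp
  obtain ⟨δ, h1, h2⟩ := (h.and (Ioc_mem_nhdsGT (show (0 : ℝ) < 1 / 2 by norm_num))).exists
  exact ⟨δ, h2.1, h2.2, fun i a b => h1 (i, a, b)⟩

theorem le_max_drop {S : Set (∀ i, A i)} {q : (∀ i, A i) → ℝ} {m : ℝ}
    (hqN : ∀ a ∉ S, q a = max 0 (φ a - m)) {b c : ∀ i, A i} (hb : b ∉ S)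
    (hm : min (φ b) (φ c) ≤ m) : q b ≤ max 0 (φ b - φ c) := by
  rw [hqN b hb]
  rcases min_le_iff.1 hm with h | h
  · rw [max_eq_left (by linarith)]
    exact le_max_left _ _
  · exact max_le_max le_rfl (by linarith)

variable [DecidableEq ι]

theorem IsPotentialGame.sub_update_lt (hA1 : Assumption1 C) (hA3 : Assumption3 U C)
    (hpot : IsPotentialGame U C φ) {a : ∀ i, A i} {i : ι} {x : A i} (hx : x ∈ C i (a i)) :
    φ a - φ (Function.update a i x) < 1 / 2 := by
  have h : a i ∈ C i (Function.update a i x i) := by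
    simpa using (hA1.1 i (a i) x).1 hx
  have h1 := hA3 i _ _ h
  have h2 := hpot i _ _ h
  simp only [Function.update_idem, Function.update_eq_self] at h1 h2
  linarith

theorem exists_crossing [Finite ι] (hA1 : Assumption1 C) {S : Set (∀ i, A i)} (hS : S.Nonempty)
    (hS' : S ≠ univ) : ∃ a ∈ S, ∃ i, ∃ x ∈ C i (a i), Function.update a i x ∉ S := by
  have := Fintype.ofFinite ι
  by_contra! h
  have hcoord : ∀ a ∈ S, ∀ i y, Function.update a i y ∈ S := by
    intro a ha i y
    obtain ⟨n, f, h0, hn, hf⟩ := hA1.2.1 i (a i) y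
    have hk : ∀ k ≤ n, Function.update a i (f k) ∈ S := by
      intro k
      induction k with
      | zero => intro _; simpa [h0] using ha
      | succ k ih =>
        intro hk
        have := h _ (ih (by omega)) i (f (k + 1)) (by simpa using hf k (by omega))
        simpa using this
    exact hn ▸ hk n le_rfl
  refine hS' (eq_univ_of_forall fun b => ?_)
  obtain ⟨a, ha⟩ := hS
  have hs : ∀ s : Finset ι, s.piecewise b a ∈ S := by
    intro s
    induction s using Finset.induction_on with
    | empty => simpa using ha
    | insert i s _ ih =>
      rw [Finset.piecewise_insert]
      exact hcoord _ ih _ _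
  simpa using hs Finset.univ

theorem halfLipschitz_cut (hA1 : Assumption1 C) (hA3 : Assumption3 U C)
    (hpot : IsPotentialGame U C φ) {S : Set (∀ i, A i)} {q : (∀ i, A i) → ℝ} {m : ℝ}
    (hqS : ∀ a ∈ S, q a = 0) (hqN : ∀ a ∉ S, q a = max 0 (φ a - m))
    (hm : ∀ b ∉ S, ∀ i, ∀ x ∈ C i (b i), Function.update b i x ∈ S →
      min (φ b) (φ (Function.update b i x)) ≤ m) : HalfLipschitz C q := by
  intro i a x hx
  have hd := hpot.sub_update_lt hA1 hA3 hx
  by_cases ha : a ∈ S <;> by_cases hb : Function.update a i x ∈ S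
  · rw [hqS _ ha, hqS _ hb]; norm_num
  · rw [hqS _ ha, hqN _ hb]
    linarith [le_max_left 0 (φ (Function.update a i x) - m)]
  · rw [hqN _ ha, hqS _ hb]
    rcases min_le_iff.1 (hm a ha i x hx hb) with h | h <;>
      exact max_le (by norm_num) (by linarith)
  · rw [hqN _ ha, hqN _ hb]
    have h0 := le_max_left 0 (φ (Function.update a i x) - m)
    have h1 := le_max_right 0 (φ (Function.update a i x) - m)
    exact max_le (by linarith) (by linarith)

end Game

section Balance

variable {ι : Type*} [Fintype ι] [DecidableEq ι] {A : ι → Type*} [∀ i, Fintype (A i)]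
  {κ : ℝ} {U : ι → (∀ i, A i) → ℝ} {C : ∀ i, A i → Finset (A i)} {ε δ : ℝ}
  {φ : (∀ i, A i) → ℝ} {μ : (∀ i, A i) × (∀ i, A i) → ℝ}

theorem phTrans_nonneg {ι : Type*} [Fintype ι] {A : ι → Type*} {κ ε : ℝ}
    (U : ι → (∀ i, A i) → ℝ) (C : ∀ i, A i → Finset (A i)) (hκ0 : 0 < κ) (hκ : κ ≤ 1 / 2)
    (hε0 : 0 < ε) (hε : ε ≤ 1 / 2) (z w : (∀ i, A i) × (∀ i, A i)) :
    0 ≤ phTrans κ U C ε z w := by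
  unfold phTrans
  split_ifs
  · exact jointProb_nonneg U C hκ0 hκ hε0 hε z w.2
  · exact le_rfl

theorem sum_phTrans (hC : ∀ i a, 3 ≤ (C i a).card) (z : (∀ i, A i) × (∀ i, A i)) :
    ∑ w, phTrans κ U C ε z w = 1 := by
  have h := sum_phTrans_mul (κ := κ) (ε := ε) U C z fun _ => 1
  simpa [sum_jointProb U C hC] using h

/-- In a cut of the joint actions, the hitting probability of `S` from a state is controlled by
the minimum of `q` over the mixtures of its components. -/
theorem exists_cut_function (hC : ∀ i a, 3 ≤ (C i a).card)
    (hκ0 : 0 < κ) (hκ : κ ≤ 1 / 2) (hε0 : 0 < ε) (hε : ε ≤ 1 / 2)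
    (hδ : δ ≤ 1 / 2) (hδU : ∀ i a b, U i b < U i a → δ ≤ U i a - U i b)
    (hsmall : Fintype.card (∀ i, A i) * (2 * Fintype.card ι + 2) * ε ^ δ ≤ 1)
    {S : Set (∀ i, A i)} {q : (∀ i, A i) → ℝ} (hq : HalfLipschitz C q)
    (hqS : ∀ a ∈ S, q a = 0) :
    ∃ f : (∀ i, A i) × (∀ i, A i) → ℝ, (∀ z, 0 ≤ f z) ∧ (∀ z, f z ≤ 1) ∧
      (∀ a ∈ S, f (a, a) = 1) ∧ (∀ a ∉ S, f (a, a) = 0) ∧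
      (∀ z, z.1 ≠ z.2 → f z = ∑ w, jointProb κ U C ε z w * f (z.2, w)) ∧
      ∀ z, f z ≤ (2 * Fintype.card ι + 2) * ε ^ mixMin q z := by
  obtain ⟨f, hf0, hf1, hfS, hfD, hfN, hfg⟩ := exists_hitting_function (phTrans κ U C ε)
    (phTrans_nonneg U C hκ0 hκ hε0 hε) (sum_phTrans hC) {z | z.1 = z.2}
    {z | z.1 = z.2 ∧ z.1 ∈ S}
  refine ⟨f, hf0, hf1, fun a ha => hfS _ ⟨rfl, ha⟩, fun a ha => hfD _ rfl fun h => ha h.2,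
    fun z hz => ?_, fun z => ?_⟩
  · rw [← sum_phTrans_mul]
    exact hfN z (fun h => hz h.1) hz
  · have hrank : ∀ z, (stateRank U z : ℝ) + 1 ≤ 2 * Fintype.card ι + 2 := fun z => by
      have := stateRank_le U z
      have : (stateRank U z : ℝ) ≤ 2 * Fintype.card ι + 1 := by exact_mod_cast this
      linarith
    refine (hfg (fun z => ((stateRank U z : ℝ) + 1) * ε ^ mixMin q z)
      (fun z => by positivity) ?_ ?_ z).trans
        (mul_le_mul_of_nonneg_right (hrank z) (by positivity))
    · rintro ⟨a, b⟩ ⟨hab, ha⟩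
      dsimp only at hab ha
      subst hab
      simp [mixMin_diag, hqS a ha]
    · intro z _ hz
      rw [sum_phTrans_mul]
      refine (sum_mul_le_greedy_add hκ0 hκ hε0 hε hδ hδU hq (by positivity)
        (fun z => by positivity) hrank z).trans ?_
      refine mul_le_mul_of_nonneg_right ?_ (by positivity)
      have h := stateRank_greedy_lt U (z := z) hz
      have h' : (stateRank U (z.2, greedy U z.1 z.2) : ℝ) + 1 ≤ stateRank U z := by
        exact_mod_cast h
      linarith

theorem sum_diag_mul_eq_zero (hμ : ∀ w, ∑ z, μ z * phTrans κ U C ε z w = μ w)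
    {f : (∀ i, A i) × (∀ i, A i) → ℝ}
    (hfN : ∀ z, z.1 ≠ z.2 → f z = ∑ w, jointProb κ U C ε z w * f (z.2, w)) :
    ∑ a, μ (a, a) * (f (a, a) - ∑ w, jointProb κ U C ε (a, a) w * f (a, w)) = 0 := by
  rw [← sum_stationary_mul (phTrans κ U C ε) μ f hμ, Fintype.sum_prod_type]
  refine Finset.sum_congr rfl fun a _ => ?_
  symm
  rw [Finset.sum_eq_single a]
  · rw [sum_phTrans_mul]
  · intro b _ hb
    rw [sum_phTrans_mul, ← hfN (a, b) hb.symm, sub_self, mul_zero]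
  · simp

/-- The constant in the comparison of the stationary weights across a cut. -/
noncomputable def cutConst (κ : ℝ) (A : ι → Type*) [∀ i, Fintype (A i)] : ℝ :=
  (Fintype.card (∀ i, A i) : ℝ) * ((Fintype.card (∀ i, A i) : ℝ) *
    (1 + 2 * (Fintype.card (∀ i, A i) * (2 * Fintype.card ι + 2)))) / deviationConst κ A ^ 2

theorem deviationConst_pos {ι : Type*} [Fintype ι] {A : ι → Type*} [∀ i, Fintype (A i)]
    [∀ i, Nonempty (A i)] {κ : ℝ} (hκ0 : 0 < κ) : 0 < deviationConst κ A :=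
  Finset.prod_pos fun _ _ => by positivity

theorem exists_weight_le_across_cut [∀ i, Nonempty (A i)]
    (hA1 : Assumption1 C) (hA3 : Assumption3 U C) (hpot : IsPotentialGame U C φ)
    (hκ0 : 0 < κ) (hκ : κ ≤ 1 / 2) (hε0 : 0 < ε) (hε : ε ≤ 1 / 2)
    (hδ : δ ≤ 1 / 2) (hδU : ∀ i a b, U i b < U i a → δ ≤ U i a - U i b)
    (hsmall : Fintype.card (∀ i, A i) * (2 * Fintype.card ι + 2) * ε ^ δ ≤ 1)
    (hμ0 : ∀ z, 0 ≤ μ z) (hμ : ∀ w, ∑ z, μ z * phTrans κ U C ε z w = μ w)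
    {S : Set (∀ i, A i)} (hS : S.Nonempty) (hS' : S ≠ univ) :
    ∃ a ∈ S, ∃ b ∉ S, μ (a, a) * ε ^ φ a ≤ cutConst κ A * (μ (b, b) * ε ^ φ b) := by
  obtain ⟨a₀, ha₀, i₀, x₀, hx₀, hb₀⟩ := exists_crossing hA1 hS hS'
  let T : Set ((∀ i, A i) × (∀ i, A i)) :=
    {p | p.1 ∈ S ∧ p.2 ∉ S ∧ ∃ i, ∃ x ∈ C i (p.1 i), p.2 = Function.update p.1 i x}
  obtain ⟨⟨a, c⟩, ⟨ha, hc, i, x, hx, hcx⟩, hmax⟩ := Set.exists_max_image T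
    (fun p => min (φ p.1) (φ p.2)) (Set.toFinite T) ⟨(a₀, _), ha₀, hb₀, i₀, x₀, hx₀, rfl⟩
  dsimp only at ha hc hx hcx
  subst hcx
  set m := min (φ a) (φ (Function.update a i x)) with hm_def
  have hm : ∀ b ∉ S, ∀ i, ∀ x ∈ C i (b i), Function.update b i x ∈ S →
      min (φ b) (φ (Function.update b i x)) ≤ m := by
    intro b hb j y hy hby
    rw [min_comm]
    exact hmax (Function.update b j y, b) ⟨hby, hb, j, b j,
      by simpa using (hA1.1 j (b j) y).1 hy, by simp⟩
  let q : (∀ i, A i) → ℝ := fun w => if w ∈ S then 0 else max 0 (φ w - m)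
  have hqS : ∀ w ∈ S, q w = 0 := fun w hw => if_pos hw
  have hqN : ∀ w ∉ S, q w = max 0 (φ w - m) := fun w hw => if_neg hw
  have hq := halfLipschitz_cut hA1 hA3 hpot hqS hqN hm
  obtain ⟨f, hf0, hf1, hfS, hfD, hfN, hfq⟩ :=
    exists_cut_function hA1.2.2 hκ0 hκ hε0 hε hδ hδU hsmall hq hqS
  have hbal := sum_diag_mul_eq_zero hμ hfN
  obtain ⟨b, hb, hbmax⟩ := Set.exists_max_image Sᶜ (fun b => μ (b, b) * ε ^ φ b)
    (Set.toFinite _) ⟨_, hc⟩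
  refine ⟨a, ha, b, hb, ?_⟩
  set N := (Fintype.card (∀ i, A i) : ℝ)
  set R := (2 * Fintype.card ι + 2 : ℝ)
  set G := N * (1 + 2 * (N * R))
  have hG0 : 0 ≤ G := by positivity
  have hE : 0 < ε ^ (1 - m) := by positivity
  have hout : ∀ w, -(G * ε ^ (1 - m) * (μ (b, b) * ε ^ φ b)) ≤
      μ (w, w) * (f (w, w) - ∑ v, jointProb κ U C ε (w, w) v * f (w, v)) := by
    intro w
    by_cases hw : w ∈ S
    · have hle : ∑ v, jointProb κ U C ε (w, w) v * f (w, v) ≤ 1 := by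
        rw [← sum_jointProb U C hA1.2.2 (w, w)]
        exact Finset.sum_le_sum fun v _ => mul_le_of_le_one_right
          (jointProb_nonneg U C hκ0 hκ hε0 hε _ _) (hf1 _)
      rw [hfS w hw]
      have h1 := mul_nonneg (hμ0 (w, w)) (sub_nonneg.2 hle)
      have h2 : 0 ≤ G * ε ^ (1 - m) * (μ (b, b) * ε ^ φ b) := by
        have := hμ0 (b, b)
        positivity
      linarith
    · have hesc := escape_le hκ0 hκ hε0 hε hq (by positivity) hfq hf0 hfN hpot hf1 hfD hw
        fun j y hy hwy => le_max_drop hqN hw (hm w hw j y hy hwy)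
      have hqw : φ w - m ≤ q w := hqN w hw ▸ le_max_right _ _
      have hpow : ε ^ (1 + q w) ≤ ε ^ (1 - m) * ε ^ φ w := by
        rw [← Real.rpow_add hε0]
        exact Real.rpow_le_rpow_of_exponent_ge hε0 (by linarith) (by linarith)
      have := hbmax w hw
      have h1 : μ (w, w) * ∑ v, jointProb κ U C ε (w, w) v * f (w, v) ≤
          G * ε ^ (1 - m) * (μ (b, b) * ε ^ φ b) := by
        calc _ ≤ μ (w, w) * (G * (ε ^ (1 - m) * ε ^ φ w)) :=
              mul_le_mul_of_nonneg_left
                (hesc.trans (mul_le_mul_of_nonneg_left hpow hG0)) (hμ0 _)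
          _ = G * ε ^ (1 - m) * (μ (w, w) * ε ^ φ w) := by ring
          _ ≤ _ := mul_le_mul_of_nonneg_left this (by positivity)
      rw [hfD w hw, zero_sub, mul_neg]
      exact neg_le_neg h1
  have hin : deviationConst κ A ^ 2 * ε ^ (1 - m) * (μ (a, a) * ε ^ φ a) ≤
      μ (a, a) * (f (a, a) - ∑ v, jointProb κ U C ε (a, a) v * f (a, v)) := by
    have hxa : x ≠ a i := fun h => hc (by rw [h]; simpa using ha)
    have h := le_one_sub_escape hA1.2.2 hκ0 hκ hε0 hε hfN hpot hf1 hfD hx hxa hc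
    have hexp : 1 + max 0 (φ a - φ (Function.update a i x)) = 1 - m + φ a := by
      rw [hm_def]
      rcases le_total (φ a) (φ (Function.update a i x)) with h | h
      · rw [min_eq_left h, max_eq_left (by linarith)]; ring
      · rw [min_eq_right h, max_eq_right (by linarith)]; ring
    rw [hexp, Real.rpow_add hε0] at h
    rw [hfS a ha]
    calc _ = μ (a, a) * (deviationConst κ A ^ 2 * (ε ^ (1 - m) * ε ^ φ a)) := by ring
      _ ≤ _ := mul_le_mul_of_nonneg_left h (hμ0 _)
  have hrest := Finset.card_nsmul_le_sum (Finset.univ.erase a) _ _ fun w _ => hout w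
  rw [← Finset.add_sum_erase _ _ (Finset.mem_univ a)] at hbal
  have hcard : ((Finset.univ.erase a).card : ℝ) ≤ N := by
    exact Nat.cast_le.2 (Finset.card_le_univ _)
  have hMb : 0 ≤ μ (b, b) * ε ^ φ b := mul_nonneg (hμ0 _) (by positivity)
  have hrest' : -(N * (G * ε ^ (1 - m) * (μ (b, b) * ε ^ φ b))) ≤
      (Finset.univ.erase a).card • -(G * ε ^ (1 - m) * (μ (b, b) * ε ^ φ b)) := by
    rw [nsmul_eq_mul, mul_neg]
    exact neg_le_neg (mul_le_mul_of_nonneg_right hcard (by positivity))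
  have hkey : ε ^ (1 - m) * (deviationConst κ A ^ 2 * (μ (a, a) * ε ^ φ a)) ≤
      ε ^ (1 - m) * (N * G * (μ (b, b) * ε ^ φ b)) := by
    linarith
  have hkey' := le_of_mul_le_mul_left hkey hE
  have hc0 : 0 < deviationConst κ A ^ 2 := pow_pos (deviationConst_pos hκ0) 2
  have hcut : cutConst κ A = N * G / deviationConst κ A ^ 2 := rfl
  rw [hcut, div_mul_eq_mul_div, le_div_iff₀ hc0]
  linarith

theorem stationary_diag_le [∀ i, Nonempty (A i)]
    (hA1 : Assumption1 C) (hA3 : Assumption3 U C) (hpot : IsPotentialGame U C φ)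
    (hκ0 : 0 < κ) (hκ : κ ≤ 1 / 2) (hε0 : 0 < ε) (hε : ε ≤ 1 / 2)
    (hδ : δ ≤ 1 / 2) (hδU : ∀ i a b, U i b < U i a → δ ≤ U i a - U i b)
    (hsmall : Fintype.card (∀ i, A i) * (2 * Fintype.card ι + 2) * ε ^ δ ≤ 1)
    (hμ0 : ∀ z, 0 ≤ μ z) (hμ : ∀ w, ∑ z, μ z * phTrans κ U C ε z w = μ w)
    (hμ1 : ∀ z, μ z ≤ 1) (a b : ∀ i, A i) :
    μ (a, a) ≤ max 1 (cutConst κ A) ^ Fintype.card (∀ i, A i) * ε ^ (φ b - φ a) := by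
  have hM : ∀ a, 0 ≤ μ (a, a) * ε ^ φ a := fun a => mul_nonneg (hμ0 _) (by positivity)
  have h := le_pow_mul_of_cut (fun a => μ (a, a) * ε ^ φ a) hM (max 1 (cutConst κ A))
    (le_max_left _ _) (fun S hS hS' => by
      obtain ⟨a, ha, b, hb, hab⟩ := exists_weight_le_across_cut hA1 hA3 hpot hκ0 hκ hε0 hε hδ hδU
        hsmall hμ0 hμ hS hS'
      exact ⟨a, ha, b, hb, hab.trans (mul_le_mul_of_nonneg_right (le_max_right _ _) (hM b))⟩) a b
  rw [Real.rpow_sub hε0, mul_div_assoc', le_div_iff₀ (by positivity)]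
  refine h.trans (mul_le_mul_of_nonneg_left ?_ (by positivity))
  exact mul_le_of_le_one_left (by positivity) (hμ1 _)

theorem stationary_off_diag_le
    (hκ0 : 0 < κ) (hκ : κ ≤ 1 / 2) (hε0 : 0 < ε) (hε : ε ≤ 1 / 2)
    (hδ : δ ≤ 1 / 2) (hδU : ∀ i a b, U i b < U i a → δ ≤ U i a - U i b)
    (hμ0 : ∀ z, 0 ≤ μ z) (hμ : ∀ w, ∑ z, μ z * phTrans κ U C ε z w = μ w)
    (hμ1 : ∑ z, μ z = 1) {z : (∀ i, A i) × (∀ i, A i)} (hz : z.1 ≠ z.2) :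
    μ z ≤ Fintype.card (∀ i, A i) * (2 * Fintype.card ι + 1) * ε ^ δ := by
  set B := (Fintype.card (∀ i, A i) * (2 * Fintype.card ι + 1) * ε ^ δ : ℝ)
  have hq : HalfLipschitz C fun _ => 0 := fun _ _ _ _ => by norm_num
  have hmix : ∀ z : (∀ i, A i) × (∀ i, A i), mixMin (fun _ => 0) z = 0 := fun z => by
    obtain ⟨_, -, h⟩ := exists_mixMin_eq (fun _ => 0) z
    exact h
  have hdrift : ∀ z, (if z.1 = z.2 then 0 else 1) - B ≤
      (stateRank U z : ℝ) - ∑ w, phTrans κ U C ε z w * stateRank U w := by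
    intro z
    have h := sum_mul_le_greedy_add hκ0 hκ hε0 hε hδ hδU hq (K := 2 * Fintype.card ι + 1)
      (by positivity) (r := fun z => (stateRank U z : ℝ)) (fun z => by positivity)
      (fun z => by exact_mod_cast stateRank_le U z) z
    simp only [hmix, Real.rpow_zero, mul_one] at h
    rw [sum_phTrans_mul U C z fun w => (stateRank U w : ℝ)]
    have hg : (stateRank U (z.2, greedy U z.1 z.2) : ℝ) + (if z.1 = z.2 then 0 else 1) ≤
        stateRank U z := by
      split_ifs with hz
      · obtain ⟨a, b⟩ := z
        dsimp only at hz
        subst hz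
        simp [greedy_diag]
      · exact_mod_cast stateRank_greedy_lt U hz
    linarith
  have hsum := sum_stationary_mul (phTrans κ U C ε) μ (fun z => (stateRank U z : ℝ)) hμ
  have hle : ∑ z, μ z * ((if z.1 = z.2 then 0 else 1) - B) ≤ 0 := by
    refine le_of_le_of_eq ?_ hsum
    exact Finset.sum_le_sum fun z _ => mul_le_mul_of_nonneg_left (hdrift z) (hμ0 z)
  simp only [mul_sub, Finset.sum_sub_distrib, ← Finset.sum_mul, hμ1, one_mul] at hle
  have hsingle := Finset.single_le_sum (f := fun z => μ z * (if z.1 = z.2 then 0 else 1))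
    (fun z _ => mul_nonneg (hμ0 z) (by split_ifs <;> norm_num)) (Finset.mem_univ z)
  simp only [hz, if_false, mul_one] at hsingle
  linarith

end Balance

section Theorems

variable {ι : Type*} [Fintype ι] [DecidableEq ι] {A : ι → Type*} [∀ i, Fintype (A i)]

theorem statement14 [∀ i, Nonempty (A i)]
    (U : ι → (∀ i, A i) → ℝ) (C : ∀ i, A i → Finset (A i)) (φ : (∀ i, A i) → ℝ)
    (κ : ℝ) (hκ0 : 0 < κ) (hκ : κ ≤ 1 / 2)
    (hA1 : Assumption1 C) (hA3 : Assumption3 U C) (hpot : IsPotentialGame U C φ)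
    (μ : ℝ → ((∀ i, A i) × (∀ i, A i)) → ℝ)
    (hμ : ∀ ε : ℝ, 0 < ε → ε ≤ 1 / 2 →
      (∀ z, 0 ≤ μ ε z) ∧ (∑ z : (∀ i, A i) × (∀ i, A i), μ ε z = 1) ∧
      (∀ z', ∑ z : (∀ i, A i) × (∀ i, A i), μ ε z * phTrans κ U C ε z z' = μ ε z') ∧
      (∀ ν : ((∀ i, A i) × (∀ i, A i)) → ℝ, (∀ z, 0 ≤ ν z) →
        (∑ z : (∀ i, A i) × (∀ i, A i), ν z = 1) →
        (∀ z', ∑ z : (∀ i, A i) × (∀ i, A i), ν z * phTrans κ U C ε z z' = ν z') → ν = μ ε))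
    (z : (∀ i, A i) × (∀ i, A i))
    (hss : ∃ L : ℝ, 0 < L ∧ Tendsto (fun ε : ℝ => μ ε z) (𝓝[>] (0 : ℝ)) (𝓝 L)) :
    ∃ a : ∀ i, A i, z = (a, a) ∧ ∀ b, φ b ≤ φ a := by
  have hμ01 : ∀ᶠ ε : ℝ in 𝓝[>] 0, ε ∈ Ioc (0 : ℝ) (1 / 2) := Ioc_mem_nhdsGT (by norm_num)
  have hpow : ∀ c K : ℝ, 0 < c → Tendsto (fun ε : ℝ => K * ε ^ c) (𝓝[>] 0) (𝓝 0) := by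
    intro c K hc
    have h := (Real.continuousAt_rpow_const 0 c (Or.inr hc.le)).tendsto.const_mul K
    rw [Real.zero_rpow hc.ne', mul_zero] at h
    exact h.mono_left nhdsWithin_le_nhds
  obtain ⟨L, hL, hlim⟩ := hss
  have hcontra : ∀ c K : ℝ, 0 < c → ¬ ∀ᶠ ε in 𝓝[>] (0 : ℝ), μ ε z ≤ K * ε ^ c :=
    fun c K hc h => hL.not_ge (le_of_tendsto_of_tendsto hlim (hpow c K hc) h)
  obtain ⟨δ, hδ0, hδ, hδU⟩ := exists_min_drop U
  by_cases hz : z.1 = z.2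
  · obtain ⟨a, b⟩ := z
    dsimp only at hz
    subst hz
    refine ⟨a, rfl, fun b => ?_⟩
    by_contra! hab
    refine hcontra (φ b - φ a) (max 1 (cutConst κ A) ^ Fintype.card (∀ i, A i)) (sub_pos.2 hab) ?_
    filter_upwards [hμ01, (hpow δ (Fintype.card (∀ i, A i) * (2 * Fintype.card ι + 2))
      hδ0).eventually_le_const zero_lt_one] with ε hε hsmall
    obtain ⟨h0, h1, hst, -⟩ := hμ ε hε.1 hε.2
    exact stationary_diag_le hA1 hA3 hpot hκ0 hκ hε.1 hε.2 hδ hδU hsmall h0 hst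
      (fun z => h1 ▸ Finset.single_le_sum (fun z _ => h0 z) (Finset.mem_univ z)) a b
  · refine absurd ?_ (hcontra δ (Fintype.card (∀ i, A i) * (2 * Fintype.card ι + 1)) hδ0)
    filter_upwards [hμ01] with ε hε
    obtain ⟨h0, h1, hst, -⟩ := hμ ε hε.1 hε.2
    exact stationary_off_diag_le hκ0 hκ hε.1 hε.2 hδ hδU h0 hst h1 hz

end Theorems
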